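/- arXiv:1911.06054 — 2 statements merged into one kernel-verified Lean document; each statement's English description precedes it below -/
import Mathlib

section
/- Let G be a finite minimal non-abelian group, i.e., G is non-abelian but every proper subgroup of G is abelian. Then G is a CG-group. -/
/-- The set of element centralizers of a group `G`. -/
def Cent (G : Type*) [Group G] : Set (Subgroup G) :=
  Set.range fun x : G => Subgroup.centralizer {x}

/-- A finite group `G` is a CG-group if `|Cent(G)| = |G'| + 2`,
where `G'` is the commutator subgroup. -/
def IsCGGroup (G : Type*) [Group G] : Prop :=
  (Cent G).ncard = Nat.card (commutator G) + 2

open scoped commutatorElement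

section MinimalNonabelian

variable {G : Type*} [Group G]

theorem mem_centralizer_singleton_conj (k x g : G) :
    g ∈ Subgroup.centralizer {k * x * k⁻¹} ↔ k⁻¹ * g * k ∈ Subgroup.centralizer {x} := by
  simp only [Subgroup.mem_centralizer_singleton_iff]
  constructor
  · intro h
    calc k⁻¹ * g * k * x = k⁻¹ * (g * (k * x * k⁻¹)) * k := by group
      _ = k⁻¹ * (k * x * k⁻¹ * g) * k := by rw [h]
      _ = x * (k⁻¹ * g * k) := by group
  · intro h
    calc g * (k * x * k⁻¹) = k * (k⁻¹ * g * k * x) * k⁻¹ := by group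
      _ = k * (x * (k⁻¹ * g * k)) * k⁻¹ := by rw [h]
      _ = k * x * k⁻¹ * g := by group

theorem mem_centralizer_singleton_self (x : G) : x ∈ Subgroup.centralizer {x} :=
  Subgroup.mem_centralizer_singleton_iff.2 rfl

theorem centralizer_singleton_eq_top_iff (x : G) :
    Subgroup.centralizer {x} = ⊤ ↔ x ∈ Subgroup.center G := by
  rw [Subgroup.centralizer_eq_top_iff_subset]
  simp

theorem conj_notMem_center {x : G} (hx : x ∉ Subgroup.center G) (k : G) :
    k * x * k⁻¹ ∉ Subgroup.center G := by
  intro h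
  apply hx
  have := (inferInstance : (Subgroup.center G).Normal).conj_mem _ h k⁻¹
  simpa [mul_assoc] using this

theorem commute_of_mem_centralizer
    (hmin : ∀ H : Subgroup G, H ≠ ⊤ → ∀ x ∈ H, ∀ y ∈ H, x * y = y * x)
    {x a b : G} (hx : x ∉ Subgroup.center G)
    (ha : a ∈ Subgroup.centralizer {x}) (hb : b ∈ Subgroup.centralizer {x}) : a * b = b * a :=
  hmin _ (mt (centralizer_singleton_eq_top_iff x).1 hx) a ha b hb

theorem isCoatom_centralizer
    (hmin : ∀ H : Subgroup G, H ≠ ⊤ → ∀ x ∈ H, ∀ y ∈ H, x * y = y * x)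
    {x : G} (hx : x ∉ Subgroup.center G) :
    IsCoatom (Subgroup.centralizer {x}) := by
  refine ⟨mt (centralizer_singleton_eq_top_iff x).1 hx, fun H hH => ?_⟩
  by_contra hne
  refine hH.not_ge fun y hy => ?_
  rw [Subgroup.mem_centralizer_singleton_iff]
  exact hmin H hne y hy x (hH.le (mem_centralizer_singleton_self x))

theorem centralizer_eq_of_mem
    (hmin : ∀ H : Subgroup G, H ≠ ⊤ → ∀ x ∈ H, ∀ y ∈ H, x * y = y * x)
    {x y : G} (hx : x ∉ Subgroup.center G)
    (hy : y ∉ Subgroup.center G) (hyx : y ∈ Subgroup.centralizer {x}) :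
    Subgroup.centralizer {y} = Subgroup.centralizer {x} := by
  have hxy : x ∈ Subgroup.centralizer {y} := by
    rw [Subgroup.mem_centralizer_singleton_iff] at hyx ⊢
    exact hyx.symm
  ext g
  constructor <;> intro hg <;> rw [Subgroup.mem_centralizer_singleton_iff]
  · exact commute_of_mem_centralizer hmin hy hg hxy
  · exact commute_of_mem_centralizer hmin hx hg hyx

theorem mem_centralizer_of_conj_mem
    (hmin : ∀ H : Subgroup G, H ≠ ⊤ → ∀ x ∈ H, ∀ y ∈ H, x * y = y * x)
    {x m k : G} (hx : x ∉ Subgroup.center G)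
    (hn : ¬ (Subgroup.centralizer {x}).Normal) (hm : m ∉ Subgroup.center G)
    (hmx : m ∈ Subgroup.centralizer {x}) (hk : k * m * k⁻¹ ∈ Subgroup.centralizer {x}) :
    k ∈ Subgroup.centralizer {x} := by
  have h1 := centralizer_eq_of_mem hmin hx (conj_notMem_center hm k) hk
  have h2 := centralizer_eq_of_mem hmin hx hm hmx
  have h3 : k ∈ Subgroup.normalizer (Subgroup.centralizer {x} : Set G) := by
    rw [Subgroup.mem_normalizer_iff]
    intro g
    have h4 := mem_centralizer_singleton_conj k m (k * g * k⁻¹)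
    rw [h1, h2] at h4
    simpa [mul_assoc] using h4.symm
  by_contra hkx
  apply hn
  rw [← Subgroup.normalizer_eq_top_iff]
  exact (isCoatom_centralizer hmin hx).2 _
    (lt_of_le_of_ne Subgroup.le_normalizer fun h => hkx (by rw [h]; exact h3))

theorem card_centralizer_sdiff_center_add
    [Finite G] (x : G) :
    ((Subgroup.centralizer {x} : Set G) \ Subgroup.center G).ncard
      + Nat.card (Subgroup.center G) = Nat.card (Subgroup.centralizer {x}) :=
  Set.ncard_sdiff_add_ncard_of_subset (Subgroup.center_le_centralizer _) (Set.toFinite _)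

theorem two_mul_card_center_le
    [Finite G] {x : G} (hx : x ∉ Subgroup.center G) :
    2 * Nat.card (Subgroup.center G) ≤ Nat.card (Subgroup.centralizer {x}) := by
  obtain ⟨k, hk⟩ := Subgroup.card_dvd_of_le (Subgroup.center_le_centralizer {x})
  have hlt : Nat.card (Subgroup.center G) < Nat.card (Subgroup.centralizer {x}) :=
    Set.ncard_lt_ncard (Set.ssubset_iff_exists.2 ⟨Subgroup.center_le_centralizer _, x,
      mem_centralizer_singleton_self x, hx⟩) (Set.toFinite _)
  rcases k with _ | _ | k
  · omega
  · omega
  · rw [hk]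
    nlinarith [Nat.zero_le (Nat.card (Subgroup.center G) * k)]

theorem card_le_two_mul_card_conjugates
    (hmin : ∀ H : Subgroup G, H ≠ ⊤ → ∀ x ∈ H, ∀ y ∈ H, x * y = y * x)
    [Finite G] {x : G} (hx : x ∉ Subgroup.center G)
    (hn : ¬ (Subgroup.centralizer {x}).Normal) :
    Nat.card G ≤ 2 * {g : G | g ∉ Subgroup.center G ∧
      ∃ h, h * g * h⁻¹ ∈ Subgroup.centralizer {x}}.ncard := by
  set M := Subgroup.centralizer {x} with hM
  have hle : ((Set.univ : Set (G ⧸ M)) ×ˢ ((M : Set G) \ Subgroup.center G)).ncard ≤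
      {g : G | g ∉ Subgroup.center G ∧ ∃ h, h * g * h⁻¹ ∈ M}.ncard := by
    refine Set.ncard_le_ncard_of_injOn (fun p => p.1.out * p.2 * p.1.out⁻¹) ?_ ?_ (Set.toFinite _)
    · rintro ⟨q, m⟩ ⟨-, hm, hmZ⟩
      refine ⟨conj_notMem_center hmZ _, q.out⁻¹, ?_⟩
      simpa [mul_assoc] using hm
    · rintro ⟨q, m⟩ ⟨-, hm, hmZ⟩ ⟨q', m'⟩ ⟨-, hm', hmZ'⟩ h
      simp only at h hm hm'
      have hconj : (q'.out⁻¹ * q.out) * m * (q'.out⁻¹ * q.out)⁻¹ = m' := by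
        calc (q'.out⁻¹ * q.out) * m * (q'.out⁻¹ * q.out)⁻¹
            = q'.out⁻¹ * (q.out * m * q.out⁻¹) * q'.out := by group
          _ = q'.out⁻¹ * (q'.out * m' * q'.out⁻¹) * q'.out := by rw [h]
          _ = m' := by group
      have hk := mem_centralizer_of_conj_mem hmin hx hn hmZ hm (hconj ▸ hm')
      have hq : q' = q := by
        rw [← Quotient.out_eq q', ← Quotient.out_eq q]
        exact QuotientGroup.eq.2 hk
      subst hq
      simpa using h
  rw [Set.ncard_prod, Set.ncard_univ] at hle
  have h1 := card_centralizer_sdiff_center_add x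
  have h2 := two_mul_card_center_le hx
  have h3 := Subgroup.card_eq_card_quotient_mul_card_subgroup M
  rw [← hM] at h1 h2
  have h4 : Nat.card M ≤ 2 * ((M : Set G) \ Subgroup.center G).ncard := by omega
  have h5 := Nat.mul_le_mul_left (Nat.card (G ⧸ M)) h4
  rw [h3]
  linarith

theorem card_conjugates_le
    (hmin : ∀ H : Subgroup G, H ≠ ⊤ → ∀ x ∈ H, ∀ y ∈ H, x * y = y * x)
    [Finite G] {x : G} (hx : x ∉ Subgroup.center G) :
    {g : G | g ∉ Subgroup.center G ∧ ∃ h, h * g * h⁻¹ ∈ Subgroup.centralizer {x}}.ncard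
      + Nat.card (Subgroup.center G) < Nat.card G := by
  set M := Subgroup.centralizer {x} with hM
  have hle : {g : G | g ∉ Subgroup.center G ∧ ∃ h, h * g * h⁻¹ ∈ M}.ncard ≤
      ((Set.univ : Set (G ⧸ M)) ×ˢ ((M : Set G) \ Subgroup.center G)).ncard := by
    refine (Set.ncard_le_ncard
      (t := Set.image (fun p : (G ⧸ M) × G => p.1.out * p.2 * p.1.out⁻¹) _) ?_ (Set.toFinite _)).trans (Set.ncard_image_le (Set.toFinite _))
    rintro g ⟨hg, h, hh⟩
    obtain ⟨⟨k, hkM⟩, hk⟩ := QuotientGroup.mk_out_eq_mul M h⁻¹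
    have hcomm : h * g * h⁻¹ * k = k * (h * g * h⁻¹) :=
      commute_of_mem_centralizer hmin hx hh hkM
    refine ⟨⟨(h⁻¹ : G), h * g * h⁻¹⟩, ⟨trivial, hh, conj_notMem_center hg h⟩, ?_⟩
    simp only
    rw [hk]
    calc h⁻¹ * k * (h * g * h⁻¹) * (h⁻¹ * k)⁻¹
        = h⁻¹ * (k * (h * g * h⁻¹)) * k⁻¹ * h := by group
      _ = h⁻¹ * (h * g * h⁻¹ * k) * k⁻¹ * h := by rw [hcomm]
      _ = g := by group
  rw [Set.ncard_prod, Set.ncard_univ] at hle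
  have h1 := card_centralizer_sdiff_center_add x
  have h3 := Subgroup.card_eq_card_quotient_mul_card_subgroup M
  rw [← hM] at h1
  have hZ : 0 < Nat.card (Subgroup.center G) := Nat.card_pos
  have hidx : 1 < Nat.card (G ⧸ M) :=
    Subgroup.one_lt_index_of_ne_top (isCoatom_centralizer hmin hx).1
  rw [h3, ← h1]
  nlinarith

theorem exists_normal_centralizer
    (hmin : ∀ H : Subgroup G, H ≠ ⊤ → ∀ x ∈ H, ∀ y ∈ H, x * y = y * x)
    [Finite G] (hna : Subgroup.center G ≠ ⊤) :
    ∃ x, x ∉ Subgroup.center G ∧ (Subgroup.centralizer {x}).Normal := by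
  by_contra! hn
  obtain ⟨x, hx⟩ : ∃ x, x ∉ Subgroup.center G := by
    by_contra! h
    exact hna (Subgroup.eq_top_iff' _ |>.2 h)
  set U : G → Set G := fun x => {g : G | g ∉ Subgroup.center G ∧
      ∃ h, h * g * h⁻¹ ∈ Subgroup.centralizer {x}} with hU
  have hZ : ((Subgroup.center G : Set G)).ncard = Nat.card (Subgroup.center G) := rfl
  have hZpos : 0 < Nat.card (Subgroup.center G) := Nat.card_pos
  have hlt := card_conjugates_le hmin hx
  obtain ⟨y, hyZ, hyU⟩ : ∃ y, y ∉ Subgroup.center G ∧ y ∉ U x := by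
    by_contra! h
    have : (Set.univ : Set G) ⊆ U x ∪ (Subgroup.center G : Set G) := fun g _ => by
      by_cases hg : g ∈ Subgroup.center G
      · exact Or.inr hg
      · exact Or.inl (h g hg)
    have h1 := Set.ncard_le_ncard this (Set.toFinite _)
    have h2 := Set.ncard_union_le (U x) (Subgroup.center G : Set G)
    rw [Set.ncard_univ] at h1
    change (U x).ncard + _ < _ at hlt
    omega
  have hd : Disjoint (U x) (U y) := by
    rw [Set.disjoint_left]
    rintro g ⟨hg, h, hh⟩ ⟨-, k, hk⟩
    have h1 := centralizer_eq_of_mem hmin hx (conj_notMem_center hg h) hh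
    have h2 := centralizer_eq_of_mem hmin hyZ (conj_notMem_center hg k) hk
    refine hyU ⟨hyZ, h * k⁻¹, ?_⟩
    have h3 := mem_centralizer_singleton_self y
    rw [← h2, mem_centralizer_singleton_conj] at h3
    rw [← h1, mem_centralizer_singleton_conj]
    simpa [mul_assoc] using h3
  have hd2 : Disjoint (U x ∪ U y) (Subgroup.center G : Set G) := by
    rw [Set.disjoint_left]
    rintro g (hg | hg) hgZ
    · exact hg.1 hgZ
    · exact hg.1 hgZ
  have h1 := card_le_two_mul_card_conjugates hmin hx (hn x hx)
  have h2 := card_le_two_mul_card_conjugates hmin hyZ (hn y hyZ)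
  have h3 := Set.ncard_union_eq hd
  have h4 := Set.ncard_union_eq hd2
  have h5 := Set.ncard_le_card (U x ∪ U y ∪ (Subgroup.center G : Set G))
  change _ ≤ 2 * (U x).ncard at h1
  change _ ≤ 2 * (U y).ncard at h2
  omega

theorem commutator_eq_range_of_isCoatom
    {N : Subgroup G} [N.Normal] (hN : IsCoatom N)
    (hab : ∀ a ∈ N, ∀ b ∈ N, a * b = b * a) {x : G} (hx : x ∉ N) :
    (commutator G : Set G) = Set.range fun n : N => ⁅(n : G), x⁆ := by
  have hconj : ∀ {n}, n ∈ N → ∀ g, g * n * g⁻¹ ∈ N := fun h g => Subgroup.Normal.conj_mem ‹_› _ h g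
  have htop : ∀ H : Subgroup G, N ≤ H → x ∈ H → H = ⊤ := fun H h1 h2 =>
    hN.2 H (lt_of_le_of_ne h1 fun h => hx (h ▸ h2))
  let φ : N →* G :=
    { toFun := fun n => ⁅(n : G), x⁆
      map_one' := by simp
      map_mul' := by
        rintro ⟨n, hn⟩ ⟨m, hm⟩
        simp only [Subgroup.coe_mul, commutatorElement_def]
        have h1 := hconj (N.inv_mem hn) x
        have h2 := N.mul_mem hm (hconj (N.inv_mem hm) x)
        calc n * m * x * (n * m)⁻¹ * x⁻¹
            = n * ((m * (x * m⁻¹ * x⁻¹)) * (x * n⁻¹ * x⁻¹)) := by group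
          _ = n * ((x * n⁻¹ * x⁻¹) * (m * (x * m⁻¹ * x⁻¹))) := by rw [hab _ h2 _ h1]
          _ = _ := by group }
  have hφN : ∀ n ∈ N, ⁅n, x⁆ ∈ N := by
    intro n hn
    have := N.mul_mem hn (hconj (N.inv_mem hn) x)
    simpa [commutatorElement_def, mul_assoc] using this
  have hnorm : φ.range.Normal := by
    have hmem : ∀ g, (∀ n ∈ N, g * ⁅n, x⁆ * g⁻¹ ∈ φ.range) →
        (∀ n ∈ N, g⁻¹ * ⁅n, x⁆ * g ∈ φ.range) → g ∈ Subgroup.normalizer (φ.range : Set G) := by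
      intro g h1 h2
      rw [Subgroup.mem_normalizer_iff]
      refine fun k => ⟨?_, fun hk => ?_⟩
      · rintro ⟨⟨n, hn⟩, rfl⟩
        exact h1 n hn
      · obtain ⟨⟨n, hn⟩, hnk⟩ := hk
        have h3 := h2 n hn
        change ⁅n, x⁆ = _ at hnk
        rw [hnk] at h3
        simpa [mul_assoc] using h3
    rw [← Subgroup.normalizer_eq_top_iff]
    refine htop _ (fun g hg => hmem g (fun n hn => ?_) fun n hn => ?_)
      (hmem x (fun n hn => ?_) fun n hn => ?_)
    · rw [hab g hg _ (hφN n hn), mul_inv_cancel_right]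
      exact ⟨⟨n, hn⟩, rfl⟩
    · rw [hab _ (N.inv_mem hg) _ (hφN n hn), inv_mul_cancel_right]
      exact ⟨⟨n, hn⟩, rfl⟩
    · refine ⟨⟨x * n * x⁻¹, hconj hn x⟩, ?_⟩
      change ⁅x * n * x⁻¹, x⁆ = _
      simp only [commutatorElement_def]
      group
    · refine ⟨⟨x⁻¹ * n * x, by simpa using hconj hn x⁻¹⟩, ?_⟩
      change ⁅x⁻¹ * n * x, x⁆ = _
      simp only [commutatorElement_def]
      group
  suffices h : commutator G = φ.range by
    rw [h]; rfl
  apply le_antisymm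
  · have hcen : (Subgroup.center (G ⧸ φ.range)).comap (QuotientGroup.mk' φ.range) = ⊤ := by
      have hNx : ∀ n ∈ N, (QuotientGroup.mk' φ.range n) * (QuotientGroup.mk' φ.range x) =
          (QuotientGroup.mk' φ.range x) * (QuotientGroup.mk' φ.range n) := by
        intro n hn
        rw [← commutatorElement_eq_one_iff_mul_comm, ← map_commutatorElement]
        exact (QuotientGroup.eq_one_iff _).2 ⟨⟨n, hn⟩, rfl⟩
      have key : ∀ a, (∀ n ∈ N, (QuotientGroup.mk' φ.range n) * (QuotientGroup.mk' φ.range a) =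
          (QuotientGroup.mk' φ.range a) * (QuotientGroup.mk' φ.range n)) →
          (QuotientGroup.mk' φ.range x) * (QuotientGroup.mk' φ.range a) =
          (QuotientGroup.mk' φ.range a) * (QuotientGroup.mk' φ.range x) →
          a ∈ (Subgroup.center (G ⧸ φ.range)).comap (QuotientGroup.mk' φ.range) := by
        intro a h1 h2
        have h3 := htop ((Subgroup.centralizer {QuotientGroup.mk' φ.range a}).comap
          (QuotientGroup.mk' φ.range))
          (fun n hn => Subgroup.mem_centralizer_singleton_iff.2 (h1 n hn))
          (Subgroup.mem_centralizer_singleton_iff.2 h2)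
        rw [Subgroup.mem_comap, Subgroup.mem_center_iff]
        intro g
        obtain ⟨g, rfl⟩ := QuotientGroup.mk'_surjective _ g
        have h4 : g ∈ (⊤ : Subgroup G) := trivial
        rw [← h3] at h4
        exact Subgroup.mem_centralizer_singleton_iff.1 h4
      refine htop _ (fun n hn => key n (fun m hm => ?_) (hNx n hn).symm) (key x hNx rfl)
      rw [← map_mul, ← map_mul, hab m hm n hn]
    rw [commutator_def, Subgroup.commutator_le]
    intro g _ h _
    have hh : h ∈ (⊤ : Subgroup G) := trivial
    rw [← hcen, Subgroup.mem_comap, Subgroup.mem_center_iff] at hh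
    rw [← QuotientGroup.eq_one_iff]
    change QuotientGroup.mk' φ.range ⁅g, h⁆ = 1
    rw [map_commutatorElement, commutatorElement_eq_one_iff_mul_comm]
    exact hh _
  · rintro _ ⟨n, rfl⟩
    exact Subgroup.commutator_mem_commutator (Subgroup.mem_top _) (Subgroup.mem_top _)

theorem centralizer_mul_eq_iff
    (hmin : ∀ H : Subgroup G, H ≠ ⊤ → ∀ x ∈ H, ∀ y ∈ H, x * y = y * x)
    {y x n m : G} (hy : y ∉ Subgroup.center G)
    (hn : n ∈ Subgroup.centralizer {y}) (hm : m ∈ Subgroup.centralizer {y})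
    (hx : x ∉ Subgroup.centralizer {y}) :
    Subgroup.centralizer {n * x} = Subgroup.centralizer {m * x} ↔ ⁅n, x⁆ = ⁅m, x⁆ := by
  have hab := fun {a b} => commute_of_mem_centralizer (a := a) (b := b) hmin hy
  have hz : ⁅n, x⁆ = ⁅m, x⁆ ↔ (m⁻¹ * n) * x = x * (m⁻¹ * n) := by
    simp only [commutatorElement_def]
    constructor
    · intro h
      calc (m⁻¹ * n) * x = m⁻¹ * (n * x * n⁻¹ * x⁻¹) * x * n := by group
        _ = m⁻¹ * (m * x * m⁻¹ * x⁻¹) * x * n := by rw [h]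
        _ = _ := by group
    · intro h
      calc n * x * n⁻¹ * x⁻¹ = m * ((m⁻¹ * n) * x) * n⁻¹ * x⁻¹ := by group
        _ = m * (x * (m⁻¹ * n)) * n⁻¹ * x⁻¹ := by rw [h]
        _ = _ := by group
  rw [hz]
  constructor
  · intro h
    have h1 := mem_centralizer_singleton_self (n * x)
    rw [h, Subgroup.mem_centralizer_singleton_iff] at h1
    have h2 : (m⁻¹ * n) * m = m * (m⁻¹ * n) := hab (mul_mem (inv_mem hm) hn) hm
    have h3 : (m⁻¹ * n) * (m * x) = (m * x) * (m⁻¹ * n) := by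
      have h4 : n * m = m * n := hab hn hm
      calc (m⁻¹ * n) * (m * x) = m⁻¹ * (n * m) * x := by group
        _ = m⁻¹ * (m * n) * x := by rw [h4]
        _ = (n * x * (m * x)) * (m * x)⁻¹ := by group
        _ = (m * x * (n * x)) * (m * x)⁻¹ := by rw [h1]
        _ = m * x * (n * m⁻¹) := by group
        _ = m * x * (m⁻¹ * n) := by rw [hab hn (inv_mem hm)]
    calc (m⁻¹ * n) * x = m⁻¹ * (m * (m⁻¹ * n)) * x := by group
      _ = m⁻¹ * ((m⁻¹ * n) * m) * x := by rw [h2]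
      _ = m⁻¹ * ((m⁻¹ * n) * (m * x)) := by group
      _ = m⁻¹ * ((m * x) * (m⁻¹ * n)) := by rw [h3]
      _ = _ := by group
  · intro h
    have hzy : m⁻¹ * n ∈ Subgroup.centralizer {y} := mul_mem (inv_mem hm) hn
    have hzc : m⁻¹ * n ∈ Subgroup.center G := by
      by_contra hzc
      apply hx
      rw [← centralizer_eq_of_mem hmin hy hzc hzy, Subgroup.mem_centralizer_singleton_iff, h]
    have h5 : n * x = (m * x) * (m⁻¹ * n) := by rw [mul_assoc, ← h]; group
    have h6 := Subgroup.mem_center_iff.1 hzc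
    rw [h5]
    ext g
    rw [Subgroup.mem_centralizer_singleton_iff, Subgroup.mem_centralizer_singleton_iff,
      mul_assoc (m * x), ← h6 g, ← mul_assoc g, ← mul_assoc (m * x) g, mul_left_inj]

theorem range_centralizer_mul_eq
    (hmin : ∀ H : Subgroup G, H ≠ ⊤ → ∀ x ∈ H, ∀ y ∈ H, x * y = y * x)
    {y x : G} (hy : y ∉ Subgroup.center G)
    (hnorm : (Subgroup.centralizer {y}).Normal) (hx : x ∉ Subgroup.centralizer {y}) :
    Set.range (fun n : Subgroup.centralizer {y} => Subgroup.centralizer {(n : G) * x}) =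
      Cent G \ {⊤, Subgroup.centralizer {y}} := by
  have hc : ∀ {g}, g ∉ Subgroup.centralizer {y} → g ∉ Subgroup.center G := fun h h' =>
    h (Subgroup.center_le_centralizer _ h')
  ext H
  simp only [Cent, Set.mem_range, Set.mem_sdiff, Set.mem_insert_iff, Set.mem_singleton_iff, not_or]
  constructor
  · rintro ⟨⟨n, hn⟩, rfl⟩
    have h1 : n * x ∉ Subgroup.centralizer {y} := by rwa [Subgroup.mul_mem_cancel_left _ hn]
    refine ⟨⟨_, rfl⟩, mt (centralizer_singleton_eq_top_iff _).1 (hc h1), fun h => h1 ?_⟩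
    rw [← h]
    exact mem_centralizer_singleton_self _
  · rintro ⟨⟨w, rfl⟩, h1, h2⟩
    have hw := mt (centralizer_singleton_eq_top_iff w).2 h1
    have hsup : Subgroup.centralizer {y} ⊔ Subgroup.centralizer {w} = ⊤ :=
      (isCoatom_centralizer hmin hy).sup_eq_top_of_ne (isCoatom_centralizer hmin hw) (Ne.symm h2)
    have hxs : x ∈ Subgroup.centralizer {y} ⊔ Subgroup.centralizer {w} := hsup ▸ trivial
    obtain ⟨n, hn, m, hm, rfl⟩ := Subgroup.mem_sup_of_normal_left.1 hxs
    refine ⟨⟨n⁻¹, inv_mem hn⟩, ?_⟩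
    simp only [inv_mul_cancel_left]
    refine centralizer_eq_of_mem hmin hw (hc fun h => hx (mul_mem hn h)) hm

end MinimalNonabelian

/-- A finite minimal non-abelian group is a CG-group. -/
theorem minimal_nonabelian_isCGGroup (G : Type*) [Group G] [Finite G]
    (hna : ¬ ∀ a b : G, a * b = b * a)
    (hmin : ∀ H : Subgroup G, H ≠ ⊤ → ∀ x ∈ H, ∀ y ∈ H, x * y = y * x) :
    IsCGGroup G := by
  have hcen : Subgroup.center G ≠ ⊤ := fun h => hna fun a b => by
    have hb : b ∈ Subgroup.center G := h ▸ trivial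
    exact Subgroup.mem_center_iff.1 hb a
  obtain ⟨y, hy, hnorm⟩ := exists_normal_centralizer hmin hcen
  have hco := isCoatom_centralizer hmin hy
  obtain ⟨x, hx⟩ : ∃ x, x ∉ Subgroup.centralizer {y} := by
    by_contra! h
    exact hco.1 (Subgroup.eq_top_iff' _ |>.2 h)
  have hker : Setoid.ker (fun n : Subgroup.centralizer {y} => Subgroup.centralizer {(n : G) * x}) =
      Setoid.ker (fun n : Subgroup.centralizer {y} => ⁅(n : G), x⁆) :=
    Setoid.ext fun n m => centralizer_mul_eq_iff hmin hy n.2 m.2 hx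
  have hcard : (Cent G \ {⊤, Subgroup.centralizer {y}}).ncard = Nat.card (commutator G) := by
    rw [← range_centralizer_mul_eq hmin hy hnorm hx]
    change _ = Nat.card (commutator G : Set G)
    rw [commutator_eq_range_of_isCoatom hco
      (fun a ha b hb => commute_of_mem_centralizer hmin hy ha hb) hx,
      ← Nat.card_coe_set_eq, ← Nat.card_congr (Setoid.quotientKerEquivRange _), hker]
    exact Nat.card_congr (Setoid.quotientKerEquivRange _)
  have hsub : {⊤, Subgroup.centralizer {y}} ⊆ Cent G := by
    rintro H (rfl | rfl)
    · exact ⟨1, (centralizer_singleton_eq_top_iff 1).2 (one_mem _)⟩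
    · exact ⟨y, rfl⟩
  rw [IsCGGroup, ← hcard, ← Set.ncard_pair hco.1.symm]
  exact (Set.ncard_sdiff_add_ncard_of_subset hsub (Set.toFinite _)).symm
end

section
/- Let G be a finite Frobenius group with kernel K and complement H, and suppose that the complement H is abelian. Then G is a CG-group if and only if the commutator subgroup G' is abelian. -/
/-- `G` is a Frobenius group with kernel `K` and complement `H`: `K` is a nontrivial
proper normal subgroup, `H` is a nontrivial subgroup, `K ∩ H = 1`, `KH = G`, and the
centralizer of every nonidentity element of `K` is contained in `K`. -/
def IsFrobeniusGroupWith (G : Type*) [Group G] (K H : Subgroup G) : Prop :=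
  K ≠ ⊥ ∧ K ≠ ⊤ ∧ K.Normal ∧ H ≠ ⊥ ∧ K ⊓ H = ⊥ ∧
    (∀ g : G, ∃ k ∈ K, ∃ h ∈ H, g = k * h) ∧
    ∀ k ∈ K, k ≠ 1 → Subgroup.centralizer {k} ≤ K

namespace IsFrobeniusGroupWith

variable {G : Type*} [Group G] {K H : Subgroup G}

theorem mem_of_commute (hF : IsFrobeniusGroupWith G K H) {k x : G} (hk : k ∈ K) (hk1 : k ≠ 1)
    (hx : k * x = x * k) : x ∈ K :=
  hF.2.2.2.2.2.2 k hk hk1 (Subgroup.mem_centralizer_singleton_iff.2 (by rw [hx]))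

theorem eq_one_of_mem (hF : IsFrobeniusGroupWith G K H) {x : G} (hk : x ∈ K) (hh : x ∈ H) :
    x = 1 := by
  have : x ∈ K ⊓ H := ⟨hk, hh⟩
  rwa [hF.2.2.2.2.1, Subgroup.mem_bot] at this

theorem eq_one_of_commute (hF : IsFrobeniusGroupWith G K H) {k h : G} (hk : k ∈ K) (hh : h ∈ H)
    (hh1 : h ≠ 1) (hc : k * h = h * k) : k = 1 := by
  by_contra hk1
  exact hh1 (hF.eq_one_of_mem (hF.mem_of_commute hk hk1 hc) hh)

/-- For `h ≠ 1` in the complement, every element of the kernel is of the form `[l, h]` with `l` in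
the kernel. -/
theorem exists_commutator_eq [Finite G] (hF : IsFrobeniusGroupWith G K H) {k h : G} (hk : k ∈ K)
    (hh : h ∈ H) (hh1 : h ≠ 1) : ∃ l ∈ K, l * h * l⁻¹ * h⁻¹ = k := by
  have hn : K.Normal := hF.2.2.1
  let f : K → K := fun l => ⟨l * h * (l : G)⁻¹ * h⁻¹, by
    have := K.mul_mem l.2 (hn.conj_mem _ (K.inv_mem l.2) h)
    simpa only [mul_assoc] using this⟩
  have hf : Function.Injective f := by
    intro a b hab
    have hab' : (a : G) * h * (a : G)⁻¹ = b * h * (b : G)⁻¹ :=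
      mul_right_cancel (congrArg Subtype.val hab)
    have h1 : (b : G)⁻¹ * a = 1 := by
      refine hF.eq_one_of_commute (K.mul_mem (K.inv_mem b.2) a.2) hh hh1 ?_
      calc (b : G)⁻¹ * a * h = (b : G)⁻¹ * (a * h * (a : G)⁻¹) * a := by group
        _ = h * ((b : G)⁻¹ * a) := by rw [hab']; group
    exact Subtype.ext (inv_mul_eq_one.1 h1).symm
  obtain ⟨l, hl⟩ := Finite.surjective_of_injective hf ⟨k, hk⟩
  exact ⟨l, l.2, congrArg Subtype.val hl⟩

theorem exists_mem_complement_ne_one (hF : IsFrobeniusGroupWith G K H) : ∃ h ∈ H, h ≠ 1 :=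
  (Subgroup.ne_bot_iff_exists_ne_one.1 hF.2.2.2.1).imp' (fun h : H => (h : G))
    fun h hh => ⟨h.2, fun h1 => hh (Subtype.ext h1)⟩

theorem exists_mem_kernel_ne_one (hF : IsFrobeniusGroupWith G K H) : ∃ k ∈ K, k ≠ 1 :=
  (Subgroup.ne_bot_iff_exists_ne_one.1 hF.1).imp' (fun k : K => (k : G))
    fun k hk => ⟨k.2, fun h1 => hk (Subtype.ext h1)⟩

theorem commutator_eq_kernel [Finite G] (hF : IsFrobeniusGroupWith G K H)
    (hH : ∀ x ∈ H, ∀ y ∈ H, x * y = y * x) : commutator G = K := by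
  have hn : K.Normal := hF.2.2.1
  apply le_antisymm
  · rw [commutator_def, Subgroup.commutator_le]
    intro x _ y _
    obtain ⟨a, ha, h, hh, rfl⟩ := hF.2.2.2.2.2.1 x
    obtain ⟨b, hb, g, hg, rfl⟩ := hF.2.2.2.2.2.1 y
    have ha' : (QuotientGroup.mk a : G ⧸ K) = 1 := (QuotientGroup.eq_one_iff a).2 ha
    have hb' : (QuotientGroup.mk b : G ⧸ K) = 1 := (QuotientGroup.eq_one_iff b).2 hb
    have hc : (QuotientGroup.mk h : G ⧸ K) * QuotientGroup.mk g
        = QuotientGroup.mk g * QuotientGroup.mk h := by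
      rw [← QuotientGroup.mk_mul, hH h hh g hg, QuotientGroup.mk_mul]
    rw [← QuotientGroup.eq_one_iff, commutatorElement_def]
    simp only [QuotientGroup.mk_mul, QuotientGroup.mk_inv, ha', hb', one_mul]
    rw [hc]
    group
  · intro k hk
    obtain ⟨h, hh, hh1⟩ := hF.exists_mem_complement_ne_one
    obtain ⟨l, -, rfl⟩ := hF.exists_commutator_eq hk hh hh1
    exact Subgroup.commutator_mem_commutator (Subgroup.mem_top l) (Subgroup.mem_top h)

/-- The centralizer of a conjugate of a nonidentity element of the complement is the conjugate of
the complement. -/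
theorem mem_centralizer_conj_iff (hF : IsFrobeniusGroupWith G K H)
    (hH : ∀ x ∈ H, ∀ y ∈ H, x * y = y * x) {h : G} (hh : h ∈ H) (hh1 : h ≠ 1) (k x : G) :
    x ∈ Subgroup.centralizer {k * h * k⁻¹} ↔ k⁻¹ * x * k ∈ H := by
  have key : x ∈ Subgroup.centralizer {k * h * k⁻¹} ↔
      k⁻¹ * x * k * h = h * (k⁻¹ * x * k) := by
    rw [Subgroup.mem_centralizer_singleton_iff, ← mul_right_inj k⁻¹, ← mul_left_inj k]
    simp only [mul_assoc, inv_mul_cancel_left, inv_mul_cancel, mul_one]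
  rw [key]
  refine ⟨fun hc => ?_, fun hx => hH _ hx _ hh⟩
  obtain ⟨l, hl, g, hg, hlg⟩ := hF.2.2.2.2.2.1 (k⁻¹ * x * k)
  rw [hlg] at hc ⊢
  have hl1 : l = 1 := by
    refine hF.eq_one_of_commute hl hh hh1 (mul_right_cancel (b := g) ?_)
    rw [mul_assoc, hH h hh g hg, ← mul_assoc, hc, mul_assoc]
  rwa [hl1, one_mul]

theorem ncard_cent [Finite G] (hF : IsFrobeniusGroupWith G K H)
    (hH : ∀ x ∈ H, ∀ y ∈ H, x * y = y * x) :
    (Cent G).ncard = Nat.card K + 1 +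
      ((fun x : G => Subgroup.centralizer {x}) '' {k | k ∈ K ∧ k ≠ 1}).ncard := by
  have hn : K.Normal := hF.2.2.1
  obtain ⟨h, hh, hh1⟩ := hF.exists_mem_complement_ne_one
  obtain ⟨k₁, hk₁, hk₁'⟩ := hF.exists_mem_kernel_ne_one
  have hhK : ∀ k, k * h * k⁻¹ ∉ K := fun k hk =>
    hh1 (hF.eq_one_of_mem (by simpa [mul_assoc] using hn.conj_mem _ hk k⁻¹) hh)
  let f : K → Subgroup G := fun k => Subgroup.centralizer {(k : G) * h * (k : G)⁻¹}
  have hf : Function.Injective f := by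
    intro a b hab
    have hmem : (a : G) * h * (a : G)⁻¹ ∈ f b := by
      rw [← hab]
      exact Subgroup.mem_centralizer_singleton_iff.2 rfl
    rw [hF.mem_centralizer_conj_iff hH hh hh1] at hmem
    have hc : (b : G)⁻¹ * a * h * ((b : G)⁻¹ * a)⁻¹ * h⁻¹ = 1 := by
      have hu : (b : G)⁻¹ * a ∈ K := K.mul_mem (K.inv_mem b.2) a.2
      refine hF.eq_one_of_mem ?_ ?_
      · have := K.mul_mem hu (hn.conj_mem _ (K.inv_mem hu) h)
        simpa only [mul_assoc] using this
      · have := H.mul_mem hmem (H.inv_mem hh)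
        simpa only [mul_assoc, mul_inv_rev, inv_inv] using this
    have h1 : (b : G)⁻¹ * a = 1 :=
      hF.eq_one_of_commute (K.mul_mem (K.inv_mem b.2) a.2) hh hh1
        (mul_inv_eq_iff_eq_mul.1 (mul_inv_eq_one.1 hc))
    exact Subtype.ext (inv_mul_eq_one.1 h1).symm
  have hCent : Cent G = insert ⊤ (Set.range f) ∪
      (fun x : G => Subgroup.centralizer {x}) '' {k | k ∈ K ∧ k ≠ 1} := by
    apply Set.Subset.antisymm
    · rintro _ ⟨x, rfl⟩
      by_cases hx1 : x = 1
      · subst hx1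
        refine Or.inl (Or.inl ?_)
        exact eq_top_iff.2 fun y _ => Subgroup.mem_centralizer_singleton_iff.2 (by simp)
      by_cases hxK : x ∈ K
      · exact Or.inr ⟨x, ⟨hxK, hx1⟩, rfl⟩
      obtain ⟨k, hk, g, hg, rfl⟩ := hF.2.2.2.2.2.1 x
      have hg1 : g ≠ 1 := by
        rintro rfl
        exact hxK (by simpa using hk)
      obtain ⟨l, hl, rfl⟩ := hF.exists_commutator_eq hk hg hg1
      refine Or.inl (Or.inr ⟨⟨l, hl⟩, ?_⟩)
      ext y
      simp only [f, inv_mul_cancel_right]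
      rw [hF.mem_centralizer_conj_iff hH hh hh1, hF.mem_centralizer_conj_iff hH hg hg1]
    · rintro _ ((rfl | ⟨k, rfl⟩) | ⟨k, -, rfl⟩)
      · exact ⟨1, eq_top_iff.2 fun y _ => Subgroup.mem_centralizer_singleton_iff.2 (by simp)⟩
      · exact ⟨_, rfl⟩
      · exact ⟨k, rfl⟩
  have htop : ⊤ ∉ Set.range f := by
    rintro ⟨k, hk⟩
    have : k₁ ∈ f k := hk ▸ Subgroup.mem_top k₁
    have h2 := Subgroup.mem_centralizer_singleton_iff.1 this
    exact hhK k (hF.mem_of_commute hk₁ hk₁' (by rw [h2]))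
  have hdisj : Disjoint (insert ⊤ (Set.range f))
      ((fun x : G => Subgroup.centralizer {x}) '' {k | k ∈ K ∧ k ≠ 1}) := by
    rw [Set.disjoint_right]
    rintro _ ⟨x, ⟨hx, hx1⟩, rfl⟩ hmem
    have hle : Subgroup.centralizer {x} ≤ K := hF.2.2.2.2.2.2 x hx hx1
    rcases hmem with htop' | ⟨k, hk⟩
    · exact hF.2.1 (top_le_iff.1 (htop' ▸ hle))
    · refine hhK k (hle ?_)
      have : (k : G) * h * (k : G)⁻¹ ∈ f k := Subgroup.mem_centralizer_singleton_iff.2 rfl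
      rwa [hk] at this
  rw [hCent, Set.ncard_union_eq hdisj, Set.ncard_insert_of_notMem htop,
    Set.ncard_range_of_injective hf]

end IsFrobeniusGroupWith

/-- A finite Frobenius group with abelian complement is a CG-group iff its commutator
subgroup is abelian. -/
theorem frobenius_abelian_complement_isCGGroup_iff (G : Type*) [Group G] [Finite G]
    (K H : Subgroup G) (hFrob : IsFrobeniusGroupWith G K H)
    (hH : ∀ x ∈ H, ∀ y ∈ H, x * y = y * x) :
    IsCGGroup G ↔ ∀ x ∈ commutator G, ∀ y ∈ commutator G, x * y = y * x := by
  rw [IsCGGroup, hFrob.ncard_cent hH, hFrob.commutator_eq_kernel hH]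
  have hcard : ∀ m n : ℕ, m + 1 + n = m + 2 ↔ n = 1 := by omega
  rw [hcard, Set.ncard_eq_one]
  constructor
  · rintro ⟨C, hC⟩ x hx y hy
    by_cases hx1 : x = 1
    · simp [hx1]
    by_cases hy1 : y = 1
    · simp [hy1]
    have hx' : Subgroup.centralizer {x} = C := by
      simpa using hC.subset (Set.mem_image_of_mem _ ⟨hx, hx1⟩)
    have hy' : Subgroup.centralizer {y} = C := by
      simpa using hC.subset (Set.mem_image_of_mem _ ⟨hy, hy1⟩)
    have hxy : x ∈ Subgroup.centralizer {y} := by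
      rw [hy', ← hx']
      exact Subgroup.mem_centralizer_singleton_iff.2 rfl
    exact Subgroup.mem_centralizer_singleton_iff.1 hxy
  · intro hK
    have hcent : ∀ k ∈ K, k ≠ 1 → Subgroup.centralizer {k} = K := fun k hk hk1 =>
      le_antisymm (hFrob.2.2.2.2.2.2 k hk hk1) fun x hx =>
        Subgroup.mem_centralizer_singleton_iff.2 (hK _ hx _ hk)
    obtain ⟨k, hk, hk1⟩ := hFrob.exists_mem_kernel_ne_one
    refine ⟨K, Set.eq_singleton_iff_unique_mem.2 ⟨⟨k, ⟨hk, hk1⟩, hcent k hk hk1⟩, ?_⟩⟩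
    rintro _ ⟨x, ⟨hx, hx1⟩, rfl⟩
    exact hcent x hx hx1
end
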